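/- For every β > 0 there exists a twice continuously differentiable function g : ℝ → ℝ with g(s) > 0 for all s ∈ ℝ, with g, g², and (g')² integrable over ℝ, such that ∫_{-∞}^{∞} g(s) ds = 1, such that g''(s)·g(s) + a·s·g'(s)·g(s) + K·g(s) + (a/2)·Λ·g(s) + (1/3)·g(s) + (1/3)·s·g'(s) = 0 for all s ∈ ℝ, where K = ∫_{-∞}^{∞} g'(s)² ds and Λ = ∫_{-∞}^{∞} g(s)² ds, and such that K + (a/2)·Λ = β. -/

import Mathlib

open MeasureTheory Filter Real

/-- `(g, -p)` are the profile and its slope, solving on `[0, S]` the profile equation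
divided by `g`, with `B = β + 1/3`. -/
structure ProfileOn (a B c S : ℝ) (g p : ℝ → ℝ) : Prop where
  g_zero : g 0 = c
  p_zero : p 0 = 0
  hasDerivAt_g : ∀ s ∈ Set.Icc 0 S, HasDerivAt g (-p s) s
  hasDerivAt_p : ∀ s ∈ Set.Icc 0 S, HasDerivAt p (B - s * p s * (a + 1 / (3 * g s))) s
  pos : ∀ s ∈ Set.Icc 0 S, 0 < g s

/-- Truncation of `x` to `[-L, L]`. -/
noncomputable def clamp (L x : ℝ) : ℝ := max (-L) (min L x)

/-- The vector field of the profile equation, truncated so as to be bounded and Lipschitz. -/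
noncomputable def truncField (a B ε L s : ℝ) (x : ℝ × ℝ) : ℝ × ℝ :=
  (-clamp L x.2, B - s * clamp L x.2 * (a + 1 / (3 * max x.1 ε)))

lemma abs_clamp_le {L : ℝ} (hL : 0 ≤ L) (x : ℝ) : |clamp L x| ≤ L := by
  rw [abs_le]
  exact ⟨le_max_left _ _, max_le (by linarith) (min_le_left _ _)⟩

lemma clamp_of_abs_le {L x : ℝ} (h : |x| ≤ L) : clamp L x = x := by
  rw [abs_le] at h
  rw [clamp, min_eq_right h.2, max_eq_right h.1]

lemma clamp_neg {L : ℝ} (hL : 0 ≤ L) (x : ℝ) : clamp L (-x) = -clamp L x := by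
  unfold clamp
  grind

lemma abs_clamp_sub_le (L x y : ℝ) : |clamp L x - clamp L y| ≤ |x - y| := by
  unfold clamp
  refine (abs_max_sub_max_le_max _ _ _ _).trans ?_
  simp only [sub_self, abs_zero]
  refine max_le (abs_nonneg _) ((abs_min_sub_min_le_max _ _ _ _).trans ?_)
  simp

lemma clamp_nonneg {L x : ℝ} (hL : 0 ≤ L) (hx : 0 ≤ x) : 0 ≤ clamp L x :=
  le_max_of_le_right (le_min hL hx)

lemma abs_inv_max_sub_le {ε : ℝ} (hε : 0 < ε) (x y : ℝ) :
    |1 / (3 * max x ε) - 1 / (3 * max y ε)| ≤ 1 / (3 * ε ^ 2) * |x - y| := by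
  have hx : ε ≤ max x ε := le_max_right _ _
  have hy : ε ≤ max y ε := le_max_right _ _
  have hxy : |max y ε - max x ε| ≤ |x - y| := by
    rw [abs_sub_comm x y]
    refine (abs_max_sub_max_le_max _ _ _ _).trans ?_
    simp
  set u := max x ε
  set w := max y ε
  have hu : 0 < u := hε.trans_le hx
  have hw : 0 < w := hε.trans_le hy
  have : 1 / (3 * u) - 1 / (3 * w) = 1 / (3 * (u * w)) * (w - u) := by field_simp
  rw [this, abs_mul, abs_of_pos (by positivity)]
  have : ε ^ 2 ≤ u * w := by nlinarith
  gcongr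

lemma inv_max_le {ε : ℝ} (hε : 0 < ε) (x : ℝ) : 1 / (3 * max x ε) ≤ 1 / (3 * ε) := by
  have hx : ε ≤ max x ε := le_max_right _ _
  gcongr

lemma exists_lipschitzWith_truncField {a B ε L T : ℝ} (ha : 0 < a) (hε : 0 < ε) (hL : 0 ≤ L)
    (hT : 0 ≤ T) :
    ∃ K : NNReal, ∀ s, |s| ≤ T → LipschitzWith K (truncField a B ε L s) := by
  set M := T * (a + 1 / (3 * ε)) + T * L * (1 / (3 * ε ^ 2)) with hM
  have hM0 : 0 ≤ M := by positivity
  refine ⟨⟨1 + M, by positivity⟩, fun s hs => LipschitzWith.of_dist_le_mul fun x y => ?_⟩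
  have h1 : |x.1 - y.1| ≤ dist x y := by rw [← Real.dist_eq]; exact le_max_left _ _
  have h2 : |x.2 - y.2| ≤ dist x y := by rw [← Real.dist_eq]; exact le_max_right _ _
  have hc := (abs_clamp_sub_le L x.2 y.2).trans h2
  have hd : 0 ≤ dist x y := dist_nonneg
  rw [Prod.dist_eq]
  change max _ _ ≤ (1 + M) * dist x y
  simp only [truncField, Real.dist_eq]
  refine max_le ?_ ?_
  · rw [neg_sub_neg, abs_sub_comm]
    nlinarith
  · have hk := (abs_inv_max_sub_le hε x.1 y.1).trans
      (mul_le_mul_of_nonneg_left h1 (by positivity))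
    have hkx : 0 ≤ 1 / (3 * max x.1 ε) := by positivity
    have hkl := inv_max_le hε x.1
    set k := 1 / (3 * max x.1 ε)
    set l := 1 / (3 * max y.1 ε)
    set P := clamp L x.2
    set Q := clamp L y.2
    have hQ : |Q| ≤ L := abs_clamp_le hL _
    have e : B - s * P * (a + k) - (B - s * Q * (a + l))
        = -(s * ((P - Q) * (a + k))) - s * (Q * (k - l)) := by ring
    rw [e]
    refine (abs_sub _ _).trans ?_
    rw [abs_neg, abs_mul, abs_mul, abs_mul, abs_mul, abs_of_nonneg (by positivity : 0 ≤ a + k)]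
    have t1 : |s| * (|P - Q| * (a + k)) ≤ T * (dist x y * (a + 1 / (3 * ε))) := by gcongr
    have t2 : |s| * (|Q| * |k - l|) ≤ T * (L * (1 / (3 * ε ^ 2) * dist x y)) := by gcongr
    nlinarith

lemma exists_norm_truncField_le {a B ε L T : ℝ} (ha : 0 < a) (hB : 0 < B) (hε : 0 < ε)
    (hL : 0 ≤ L) (hT : 0 ≤ T) :
    ∃ M : NNReal, ∀ s, |s| ≤ T → ∀ x, ‖truncField a B ε L s x‖ ≤ M := by
  refine ⟨⟨L + B + T * L * (a + 1 / (3 * ε)), by positivity⟩, fun s hs x => ?_⟩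
  have hP := abs_clamp_le hL x.2
  have hkx : 0 ≤ 1 / (3 * max x.1 ε) := by positivity
  have hkl := inv_max_le hε x.1
  change max _ _ ≤ L + B + T * L * (a + 1 / (3 * ε))
  have h0 : 0 ≤ T * L * (a + 1 / (3 * ε)) := by positivity
  simp only [truncField, Real.norm_eq_abs]
  refine max_le (by rw [abs_neg]; linarith) ?_
  refine (abs_sub _ _).trans ?_
  rw [abs_mul, abs_mul, abs_of_pos hB, abs_of_nonneg (by positivity : 0 ≤ a + 1 / (3 * max x.1 ε))]
  have : |s| * |clamp L x.2| * (a + 1 / (3 * max x.1 ε)) ≤ T * L * (a + 1 / (3 * ε)) := by gcongr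
  linarith

lemma exists_truncField_solution {a B ε L T : ℝ} (ha : 0 < a) (hB : 0 < B) (hε : 0 < ε)
    (hL : 0 ≤ L) (hT : 0 < T) (c : ℝ) :
    ∃ α : ℝ → ℝ × ℝ, α 0 = (c, 0) ∧
      ∀ s, |s| < T → HasDerivAt α (truncField a B ε L s (α s)) s := by
  obtain ⟨K, hK⟩ := exists_lipschitzWith_truncField (B := B) ha hε hL hT.le
  obtain ⟨M, hM⟩ := exists_norm_truncField_le ha hB hε hL hT.le
  have hpl : IsPicardLindelof (truncField a B ε L) (tmin := -T) (tmax := T)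
      ⟨0, by constructor <;> linarith⟩ (c, 0) (M * ⟨T, hT.le⟩) 0 M K := by
    refine ⟨fun t ht => (hK t (abs_le.2 ht)).lipschitzOnWith, fun x _ => ?_,
      fun t ht x _ => hM t (abs_le.2 ht) x, ?_⟩
    · apply Continuous.continuousOn
      unfold truncField
      fun_prop
    · simp only [sub_zero, zero_sub, neg_neg, max_self, NNReal.coe_zero]
      exact le_rfl
  obtain ⟨α, h0, hα⟩ := hpl.exists_eq_forall_mem_Icc_hasDerivWithinAt₀
  refine ⟨α, h0, fun s hs => ?_⟩
  rw [abs_lt] at hs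
  exact (hα s ⟨hs.1.le, hs.2.le⟩).hasDerivAt (Icc_mem_nhds hs.1 hs.2)

/-- Barrier bounds `0 ≤ p ≤ B s` for a slope equation with nonnegative damping. -/
lemma slope_bounds {B S : ℝ} (hB : 0 < B) {p q : ℝ → ℝ} (hp0 : p 0 = 0)
    (hp : ∀ s ∈ Set.Icc 0 S, HasDerivAt p (B - q s) s)
    (hq0 : ∀ s ∈ Set.Icc 0 S, p s = 0 → q s = 0)
    (hq : ∀ s ∈ Set.Icc 0 S, 0 ≤ p s → 0 ≤ q s) :
    ∀ s ∈ Set.Icc 0 S, 0 ≤ p s ∧ p s ≤ B * s := by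
  have hc : ContinuousOn p (Set.Icc 0 S) := fun s hs => (hp s hs).continuousAt.continuousWithinAt
  have h0 : ∀ s ∈ Set.Icc 0 S, 0 ≤ p s := fun s hs => by
    have := image_le_of_deriv_right_lt_deriv_boundary (f := fun s => -p s)
      (f' := fun s => -(B - q s)) (B := fun _ => 0) (B' := fun _ => 0) hc.neg
      (fun s hs => (hp s (Set.Ico_subset_Icc_self hs)).neg.hasDerivWithinAt) (by simp [hp0])
      (fun x => hasDerivAt_const x 0)
      (fun x hx h => by
        rw [hq0 x (Set.Ico_subset_Icc_self hx) (by linarith)]; linarith) hs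
    linarith
  refine fun s hs => ⟨h0 s hs, ?_⟩
  refine image_le_of_deriv_right_le_deriv_boundary (f := p) (f' := fun s => B - q s)
    (B := fun s => B * s) (B' := fun _ => B) hc
    (fun s hs => (hp s (Set.Ico_subset_Icc_self hs)).hasDerivWithinAt) (by simp [hp0])
    (by fun_prop) (fun x _ => by simpa using ((hasDerivAt_id x).const_mul B).hasDerivWithinAt)
    (fun x hx => ?_) hs
  linarith [hq x (Set.Ico_subset_Icc_self hx) (h0 x (Set.Ico_subset_Icc_self hx))]

lemma antitoneOn_of_hasDerivAt_neg {S : ℝ} {g p : ℝ → ℝ}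
    (hg : ∀ s ∈ Set.Icc 0 S, HasDerivAt g (-p s) s) (hp : ∀ s ∈ Set.Icc 0 S, 0 ≤ p s) :
    AntitoneOn g (Set.Icc 0 S) := by
  refine antitoneOn_of_deriv_nonpos (convex_Icc _ _)
    (fun s hs => (hg s hs).continuousAt.continuousWithinAt)
    (fun s hs => (hg s (interior_subset hs)).differentiableAt.differentiableWithinAt)
    (fun s hs => ?_)
  rw [(hg s (interior_subset hs)).deriv]
  linarith [hp s (interior_subset hs)]

lemma sub_sq_le_of_slope_le {B c S : ℝ} {g p : ℝ → ℝ} (g0 : g 0 = c)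
    (hg : ∀ s ∈ Set.Icc 0 S, HasDerivAt g (-p s) s) (hp : ∀ s ∈ Set.Icc 0 S, p s ≤ B * s) :
    ∀ s ∈ Set.Icc 0 S, c - B * s ^ 2 / 2 ≤ g s := by
  intro s hs
  have := image_le_of_deriv_right_le_deriv_boundary (f := fun s => c - B * s ^ 2 / 2)
    (f' := fun s => -(B * s)) (B := g) (B' := fun s => -p s) (a := 0) (b := S) (by fun_prop)
    (fun x _ => by
      have := (((hasDerivAt_pow 2 x).const_mul B).div_const 2).const_sub c
      refine (this.congr_deriv ?_).hasDerivWithinAt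
      push_cast
      ring) (by simp [g0])
    (fun s hs => (hg s hs).continuousAt.continuousWithinAt)
    (fun s hs => (hg s (Set.Ico_subset_Icc_self hs)).hasDerivWithinAt)
    (fun x hx => by linarith [hp x (Set.Ico_subset_Icc_self hx)]) hs
  exact this

namespace ProfileOn

variable {a B c S : ℝ} {g p : ℝ → ℝ}

lemma mono {S' : ℝ} (h : ProfileOn a B c S g p) (hS : S' ≤ S) : ProfileOn a B c S' g p :=
  have hsub : Set.Icc 0 S' ⊆ Set.Icc 0 S := Set.Icc_subset_Icc_right hS
  ⟨h.g_zero, h.p_zero, fun s hs => h.hasDerivAt_g s (hsub hs),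
    fun s hs => h.hasDerivAt_p s (hsub hs), fun s hs => h.pos s (hsub hs)⟩

lemma bounds_p (h : ProfileOn a B c S g p) (ha : 0 < a) (hB : 0 < B) :
    ∀ s ∈ Set.Icc 0 S, 0 ≤ p s ∧ p s ≤ B * s := by
  refine slope_bounds hB h.p_zero h.hasDerivAt_p (fun s _ h0 => by simp [h0]) fun s hs h0 => ?_
  have := h.pos s hs
  have := hs.1
  positivity

lemma antitoneOn (h : ProfileOn a B c S g p) (ha : 0 < a) (hB : 0 < B) :
    AntitoneOn g (Set.Icc 0 S) :=
  antitoneOn_of_hasDerivAt_neg h.hasDerivAt_g fun s hs => (h.bounds_p ha hB s hs).1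

lemma le_init (h : ProfileOn a B c S g p) (ha : 0 < a) (hB : 0 < B) :
    ∀ s ∈ Set.Icc 0 S, g s ≤ c := fun s hs => by
  rw [← h.g_zero]
  exact h.antitoneOn ha hB ⟨le_rfl, hs.1.trans hs.2⟩ hs hs.1

lemma quadratic_le (h : ProfileOn a B c S g p) (ha : 0 < a) (hB : 0 < B) :
    ∀ s ∈ Set.Icc 0 S, c - B * s ^ 2 / 2 ≤ g s :=
  sub_sq_le_of_slope_le h.g_zero h.hasDerivAt_g fun s hs => (h.bounds_p ha hB s hs).2

/-- A lower bound for profiles on `[0, T]`, uniform for initial values at least `c₁`. -/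
lemma lower_bound {c₁ T : ℝ} (h : ProfileOn a B c S g p) (ha : 0 < a) (hB : 0 < B)
    (hc₁ : 0 < c₁) (hc : c₁ ≤ c) (hS : 0 ≤ S) (hST : S ≤ T) :
    c₁ / 2 * exp (-(3 * B * T / √(c₁ / B))) ≤ g S := by
  have hSm : S ∈ Set.Icc 0 S := ⟨hS, le_rfl⟩
  set δ := √(c₁ / B) with hδ
  have hδ0 : 0 < δ := by positivity
  have hδ2 : B * δ ^ 2 = c₁ := by
    rw [hδ, Real.sq_sqrt (by positivity)]
    field_simp
  rcases le_total S δ with hle | hle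
  · have h1 := h.quadratic_le ha hB S hSm
    have h2 : exp (-(3 * B * T / δ)) ≤ 1 := by
      rw [exp_le_one_iff]
      have : 0 ≤ T := hS.trans hST
      have : 0 ≤ 3 * B * T / δ := by positivity
      linarith
    have h3 : B * S ^ 2 ≤ c₁ := by
      rw [← hδ2]
      gcongr
    nlinarith
  · have hδm : δ ∈ Set.Icc 0 S := ⟨hδ0.le, hle⟩
    have hsub : Set.Icc δ S ⊆ Set.Icc 0 S := Set.Icc_subset_Icc_left hδ0.le
    have hder : ∀ s ∈ Set.Icc δ S, HasDerivAt (fun s => p s - B * s - δ / 3 * log (g s))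
        (-p s * (s * a + (s - δ) / (3 * g s))) s := fun s hs => by
      have hg := h.pos s (hsub hs)
      have := ((h.hasDerivAt_p s (hsub hs)).sub ((hasDerivAt_id s).const_mul B)).sub
        (((h.hasDerivAt_g s (hsub hs)).log hg.ne').const_mul (δ / 3))
      refine this.congr_deriv ?_
      field_simp
      ring
    have hanti : AntitoneOn (fun s => p s - B * s - δ / 3 * log (g s)) (Set.Icc δ S) := by
      refine antitoneOn_of_deriv_nonpos (convex_Icc _ _)
        (fun s hs => (hder s hs).continuousAt.continuousWithinAt)
        (fun s hs => (hder s (interior_subset hs)).differentiableAt.differentiableWithinAt)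
        (fun s hs => ?_)
      have hs' := interior_subset hs
      rw [(hder s hs').deriv]
      have hg := h.pos s (hsub hs')
      have hp := (h.bounds_p ha hB s (hsub hs')).1
      have h1 : 0 ≤ s := (hsub hs').1
      have h2 : 0 ≤ s - δ := by linarith [hs'.1]
      have : 0 ≤ p s * (s * a + (s - δ) / (3 * g s)) := by positivity
      linarith
    have h1 := hanti ⟨le_rfl, hle⟩ ⟨hle, le_rfl⟩ hle
    simp only at h1
    have h2 := (h.bounds_p ha hB S hSm).1
    have h3 := (h.bounds_p ha hB δ hδm).2
    have h4 : c₁ / 2 ≤ g δ := by linarith [h.quadratic_le ha hB δ hδm]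
    have h5 : log (c₁ / 2) ≤ log (g δ) := log_le_log (by positivity) h4
    have h6 : log (c₁ / 2) - 3 * B * T / δ ≤ log (g S) := by
      have h7 : δ / 3 * log (c₁ / 2) ≤ δ / 3 * log (g δ) := by gcongr
      have h8 : B * S ≤ B * T := by gcongr
      have h9 : δ / 3 * (log (c₁ / 2) - 3 * B * T / δ) = δ / 3 * log (c₁ / 2) - B * T := by
        field_simp
      refine le_of_mul_le_mul_left ?_ (by positivity : 0 < δ / 3)
      linarith
    calc c₁ / 2 * exp (-(3 * B * T / δ)) = exp (log (c₁ / 2) - 3 * B * T / δ) := by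
          rw [sub_eq_add_neg, exp_add, exp_log (by positivity)]
      _ ≤ exp (log (g S)) := exp_le_exp.2 h6
      _ = g S := exp_log (h.pos S hSm)

lemma hasDerivAt_prodMk {ε : ℝ} (h : ProfileOn a B c S g p) (ha : 0 < a) (hB : 0 < B)
    (hε : ∀ s ∈ Set.Icc 0 S, ε ≤ g s) {s : ℝ} (hs : s ∈ Set.Icc 0 S) :
    HasDerivAt (fun s => (g s, p s)) (truncField a B ε (B * S) s (g s, p s)) s := by
  have hp := h.bounds_p ha hB s hs
  have hcl : clamp (B * S) (p s) = p s := clamp_of_abs_le (by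
    rw [abs_of_nonneg hp.1]
    exact hp.2.trans (by gcongr; exact hs.2))
  simp only [truncField, hcl, max_eq_left (hε s hs)]
  exact (h.hasDerivAt_g s hs).prodMk (h.hasDerivAt_p s hs)

end ProfileOn

/-- The threshold of truncation used for profiles on `[0, T]` with initial value at least `c`. -/
noncomputable def profileFloor (B c T : ℝ) : ℝ := c / 4 * exp (-(3 * B * T / √(c / B)))

lemma profileFloor_pos {B c T : ℝ} (hc : 0 < c) : 0 < profileFloor B c T := by
  unfold profileFloor
  positivity

lemma ProfileOn.profileFloor_lt {a B c c₁ S T : ℝ} {g p : ℝ → ℝ} (h : ProfileOn a B c S g p)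
    (ha : 0 < a) (hB : 0 < B) (hc₁ : 0 < c₁) (hc : c₁ ≤ c) (hST : S ≤ T) :
    ∀ s ∈ Set.Icc 0 S, profileFloor B c₁ T < g s := fun s hs => by
  have h1 := (h.mono hs.2).lower_bound ha hB hc₁ hc hs.1 (hs.2.trans hST)
  have h2 := profileFloor_pos (B := B) (T := T) hc₁
  have h3 : profileFloor B c₁ T * 2 = c₁ / 2 * exp (-(3 * B * T / √(c₁ / B))) := by
    unfold profileFloor
    ring
  linarith

/-- Continuous dependence of profiles on the initial value. -/
lemma exists_abs_sub_le {a B c₁ S : ℝ} (ha : 0 < a) (hB : 0 < B) (hc₁ : 0 < c₁) (hS : 0 ≤ S) :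
    ∃ M : ℝ, ∀ c c' : ℝ, ∀ g p g' p' : ℝ → ℝ, c₁ ≤ c → c₁ ≤ c' →
      ProfileOn a B c S g p → ProfileOn a B c' S g' p' →
      ∀ s ∈ Set.Icc 0 S, |g s - g' s| ≤ |c - c'| * M ∧ |p s - p' s| ≤ |c - c'| * M := by
  obtain ⟨K, hK⟩ := exists_lipschitzWith_truncField (B := B) ha
    (profileFloor_pos (B := B) (T := S) hc₁) (by positivity : 0 ≤ B * S) hS
  refine ⟨exp (K * S), fun c c' g p g' p' hc hc' h h' s hs => ?_⟩
  have e := fun t ht => h.hasDerivAt_prodMk ha hB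
    (fun s hs => (h.profileFloor_lt ha hB hc₁ hc le_rfl s hs).le) (s := t) ht
  have e' := fun t ht => h'.hasDerivAt_prodMk ha hB
    (fun s hs => (h'.profileFloor_lt ha hB hc₁ hc' le_rfl s hs).le) (s := t) ht
  have key := dist_le_of_trajectories_ODE_of_mem (s := fun _ => Set.univ) (δ := |c - c'|)
    (fun t ht => (hK t (by rw [abs_of_nonneg ht.1]; exact ht.2.le)).lipschitzOnWith)
    (fun t ht => (e t ht).continuousAt.continuousWithinAt)
    (fun t ht => (e t (Set.Ico_subset_Icc_self ht)).hasDerivWithinAt) (fun _ _ => trivial)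
    (fun t ht => (e' t ht).continuousAt.continuousWithinAt)
    (fun t ht => (e' t (Set.Ico_subset_Icc_self ht)).hasDerivWithinAt) (fun _ _ => trivial)
    (by simp [Prod.dist_eq, Real.dist_eq, h.g_zero, h'.g_zero, h.p_zero, h'.p_zero]) s hs
  have hle : |c - c'| * exp (K * (s - 0)) ≤ |c - c'| * exp (K * S) := by
    gcongr
    linarith [hs.2]
  rw [Prod.dist_eq] at key
  exact ⟨((le_max_left _ _).trans key).trans hle, ((le_max_right _ _).trans key).trans hle⟩

lemma ProfileOn.eqOn {a B c S : ℝ} {g p g' p' : ℝ → ℝ} (ha : 0 < a) (hB : 0 < B) (hc : 0 < c)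
    (h : ProfileOn a B c S g p) (h' : ProfileOn a B c S g' p') :
    ∀ s ∈ Set.Icc 0 S, g s = g' s ∧ p s = p' s := fun s hs => by
  obtain ⟨M, hM⟩ := exists_abs_sub_le ha hB hc (hs.1.trans hs.2)
  have := hM c c g p g' p' le_rfl le_rfl h h' s hs
  simpa [sub_eq_zero] using this

/-- Solutions of the truncated system solve the profile equation. -/
lemma profileOn_of_truncField {a B c S : ℝ} (ha : 0 < a) (hB : 0 < B) (hc : 0 < c)
    {g p : ℝ → ℝ} (g0 : g 0 = c) (p0 : p 0 = 0)
    (h : ∀ s ∈ Set.Icc 0 S, HasDerivAt (fun s => (g s, p s))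
      (truncField a B (profileFloor B c S) (B * S) s (g s, p s)) s) :
    ProfileOn a B c S g p := by
  set ε := profileFloor B c S with hεd
  have hε : 0 < ε := profileFloor_pos hc
  have hg1 : ∀ s ∈ Set.Icc 0 S, HasDerivAt g (-clamp (B * S) (p s)) s := fun s hs =>
    (h s hs).fst
  have hp1 : ∀ s ∈ Set.Icc 0 S, HasDerivAt p
      (B - s * clamp (B * S) (p s) * (a + 1 / (3 * max (g s) ε))) s := fun s hs => (h s hs).snd
  have hL : ∀ s ∈ Set.Icc 0 S, 0 ≤ B * S := fun s hs => mul_nonneg hB.le (hs.1.trans hs.2)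
  have hb := slope_bounds hB p0 hp1
    (fun s hs h0 => by rw [h0, clamp_of_abs_le (by simpa using hL s hs)]; simp)
    (fun s hs h0 => by
      have := clamp_nonneg (hL s hs) h0
      have := hs.1
      positivity)
  have hcl : ∀ s ∈ Set.Icc 0 S, clamp (B * S) (p s) = p s := fun s hs =>
    clamp_of_abs_le (by
      rw [abs_of_nonneg (hb s hs).1]
      exact (hb s hs).2.trans (by gcongr; exact hs.2))
  have hg2 : ∀ s ∈ Set.Icc 0 S, HasDerivAt g (-p s) s := fun s hs => by
    rw [← hcl s hs]; exact hg1 s hs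
  have hp2 : ∀ s ∈ Set.Icc 0 S, HasDerivAt p (B - s * p s * (a + 1 / (3 * max (g s) ε))) s :=
    fun s hs => by
      have := hp1 s hs
      rwa [hcl s hs] at this
  have hanti := antitoneOn_of_hasDerivAt_neg hg2 fun s hs => (hb s hs).1
  have hreal : ∀ S' ≤ S, (∀ s ∈ Set.Icc 0 S', ε ≤ g s) → ProfileOn a B c S' g p := by
    intro S' hS' hε'
    have hsub : Set.Icc 0 S' ⊆ Set.Icc 0 S := Set.Icc_subset_Icc_right hS'
    refine ⟨g0, p0, fun s hs => hg2 s (hsub hs), fun s hs => ?_, fun s hs => hε.trans_le (hε' s hs)⟩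
    have := hp2 s (hsub hs)
    rwa [max_eq_left (hε' s hs)] at this
  refine hreal S le_rfl fun s hs => ?_
  by_contra! hlt
  have hεc : ε ≤ g 0 := by
    have h0S : 0 ≤ S := hs.1.trans hs.2
    have : exp (-(3 * B * S / √(c / B))) ≤ 1 := by
      rw [exp_le_one_iff, neg_nonpos]
      positivity
    rw [g0, hεd, profileFloor]
    nlinarith
  obtain ⟨s₁, hs₁, he⟩ := intermediate_value_Icc' hs.1
    (fun t ht => (hg2 t ⟨ht.1, ht.2.trans hs.2⟩).continuousAt.continuousWithinAt) ⟨hlt.le, hεc⟩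
  have hs₁S : s₁ ≤ S := hs₁.2.trans hs.2
  have hpr := hreal s₁ hs₁S fun t ht => by
    rw [← he]
    exact hanti ⟨ht.1, ht.2.trans hs₁S⟩ ⟨hs₁.1, hs₁S⟩ ht.2
  have := hpr.profileFloor_lt ha hB hc le_rfl hs₁S s₁ ⟨hs₁.1, le_rfl⟩
  rw [he] at this
  exact lt_irrefl _ this

/-- Existence of profiles on symmetric intervals. -/
lemma exists_profileOn {a B c T : ℝ} (ha : 0 < a) (hB : 0 < B) (hc : 0 < c) (hT : 0 ≤ T) :
    ∃ g p : ℝ → ℝ, ProfileOn a B c T g p ∧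
      ProfileOn a B c T (fun s => g (-s)) (fun s => -p (-s)) := by
  have hL : 0 ≤ B * T := by positivity
  obtain ⟨α, h0, hα⟩ := exists_truncField_solution (T := T + 1) ha hB
    (profileFloor_pos (B := B) (T := T) hc) hL (by linarith) c
  refine ⟨fun s => (α s).1, fun s => (α s).2, ?_, ?_⟩
  · refine profileOn_of_truncField ha hB hc (by simp [h0]) (by simp [h0]) fun s hs => ?_
    exact hα s (by rw [abs_of_nonneg hs.1]; linarith [hs.2])
  · refine profileOn_of_truncField ha hB hc (by simp [h0]) (by simp [h0]) fun s hs => ?_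
    have h1 := hα (-s) (by rw [abs_neg, abs_of_nonneg hs.1]; linarith [hs.2])
    have h2 := h1.scomp s (hasDerivAt_neg s)
    set v := truncField a B (profileFloor B c T) (B * T) (-s) (α (-s)) with hv
    have h3 : HasDerivAt (fun s => (α (-s)).1) ((-1 : ℝ) • v).1 s := h2.fst
    have h4 : HasDerivAt (fun s => (α (-s)).2) ((-1 : ℝ) • v).2 s := h2.snd
    refine (h3.prodMk h4.neg).congr_deriv ?_
    rw [hv]
    simp only [truncField, clamp_neg hL]
    ext <;> simp

namespace ProfileOn

variable {a B c S : ℝ} {g p : ℝ → ℝ}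

lemma deriv_p_le (h : ProfileOn a B c S g p) (ha : 0 < a) (hB : 0 < B) :
    ∀ s ∈ Set.Icc 0 S, B - s * p s * (a + 1 / (3 * g s)) ≤ B / (1 + a * s ^ 2 / 2) := by
  intro s hs
  have hpos : ∀ x : ℝ, 0 < 1 + a * x ^ 2 / 2 := fun x => by positivity
  have hz : ∀ s ∈ Set.Icc 0 S, HasDerivAt (fun s => B - s * p s * (a + 1 / (3 * g s)))
      (-(p s * (a + 1 / (3 * g s)) + s * (B - s * p s * (a + 1 / (3 * g s))) * (a + 1 / (3 * g s))
        + s * p s ^ 2 / (3 * g s ^ 2))) s := fun s hs => by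
    have hg := h.pos s hs
    have h1 := ((hasDerivAt_const s (1 : ℝ)).div ((h.hasDerivAt_g s hs).const_mul 3)
      (by positivity)).const_add a
    have h2 := (((hasDerivAt_id s).mul (h.hasDerivAt_p s hs)).mul h1).const_sub B
    refine h2.congr_deriv ?_
    simp only [id, Pi.mul_apply, Pi.div_apply]
    field_simp
    ring
  have hb : ∀ η x : ℝ, HasDerivAt (fun x => (B + η) / (1 + a * x ^ 2 / 2))
      (-((B + η) / (1 + a * x ^ 2 / 2) * (a * x / (1 + a * x ^ 2 / 2)))) x := fun η x => by
    have h1 := (((hasDerivAt_pow 2 x).const_mul a).div_const 2).const_add 1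
    refine ((hasDerivAt_const x (B + η)).div h1 (hpos x).ne').congr_deriv ?_
    have := (hpos x).ne'
    push_cast
    field_simp
    ring
  have key : ∀ η > 0, B - s * p s * (a + 1 / (3 * g s)) ≤ (B + η) / (1 + a * s ^ 2 / 2) := by
    intro η hη
    refine image_le_of_deriv_right_lt_deriv_boundary (a := 0) (b := S)
      (fun s hs => (hz s hs).continuousAt.continuousWithinAt)
      (fun s hs => (hz s (Set.Ico_subset_Icc_self hs)).hasDerivWithinAt) (by simp [hη.le]) (hb η)
      (fun x hx he => ?_) hs
    have hx' := Set.Ico_subset_Icc_self hx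
    have hg := h.pos x hx'
    have hp := (h.bounds_p ha hB x hx').1
    rcases hx.1.eq_or_lt with rfl | hx0
    · simp at he
      linarith
    · rw [he]
      set b := (B + η) / (1 + a * x ^ 2 / 2) with hbd
      have hb0 : 0 < b := div_pos (by linarith) (hpos x)
      have h1 : 0 ≤ p x * (a + 1 / (3 * g x)) := by positivity
      have h2 : 0 ≤ x * p x ^ 2 / (3 * g x ^ 2) := by positivity
      have h3 : b * (a * x / (1 + a * x ^ 2 / 2)) ≤ x * b * a := by
        have : a * x / (1 + a * x ^ 2 / 2) ≤ a * x :=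
          div_le_self (by positivity) (by linarith [show 0 ≤ a * x ^ 2 / 2 by positivity])
        nlinarith
      have h4 : 0 < x * b * (1 / (3 * g x)) := by positivity
      nlinarith
  have h5 : ∀ η > 0, (B - s * p s * (a + 1 / (3 * g s))) * (1 + a * s ^ 2 / 2) ≤ B + η :=
    fun η hη => (le_div_iff₀ (hpos s)).1 (key η hη)
  exact (le_div_iff₀ (hpos s)).2 (le_of_forall_pos_le_add h5)

lemma log_le (h : ProfileOn a B c S g p) (ha : 0 < a) (hB : 0 < B) :
    ∀ s ∈ Set.Icc 0 S, a * g s + log (g s) / 3 + B / 2 * log (1 + a * s ^ 2 / 2) ≤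
      a * c + log c / 3 := by
  intro s hs
  have hpos : ∀ x : ℝ, 0 < 1 + a * x ^ 2 / 2 := fun x => by positivity
  have hd : ∀ s ∈ Set.Icc 0 S,
      HasDerivAt (fun s => a * g s + log (g s) / 3 + B / 2 * log (1 + a * s ^ 2 / 2))
        (-(p s * (a + 1 / (3 * g s))) + B * (a * s / 2) / (1 + a * s ^ 2 / 2)) s := fun s hs => by
    have hg := h.pos s hs
    have h1 := (((hasDerivAt_pow 2 s).const_mul a).div_const 2).const_add 1
    have h2 := (((h.hasDerivAt_g s hs).const_mul a).add
      (((h.hasDerivAt_g s hs).log hg.ne').div_const 3)).add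
      ((h1.log (hpos s).ne').const_mul (B / 2))
    refine h2.congr_deriv ?_
    have := (hpos s).ne'
    push_cast
    field_simp
    ring
  have hanti : AntitoneOn (fun s => a * g s + log (g s) / 3 + B / 2 * log (1 + a * s ^ 2 / 2))
      (Set.Icc 0 S) := by
    refine antitoneOn_of_deriv_nonpos (convex_Icc _ _)
      (fun s hs => (hd s hs).continuousAt.continuousWithinAt)
      (fun s hs => (hd s (interior_subset hs)).differentiableAt.differentiableWithinAt)
      (fun s hs => ?_)
    have hs' := interior_subset hs
    rw [interior_Icc] at hs
    rw [(hd s hs').deriv]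
    have h1 := h.deriv_p_le ha hB s hs'
    have h2 : B - B / (1 + a * s ^ 2 / 2) = s * (B * (a * s / 2) / (1 + a * s ^ 2 / 2)) := by
      have := (hpos s).ne'
      field_simp
      ring
    refine le_of_mul_le_mul_left (a := s) ?_ hs.1
    linarith
  have := hanti ⟨le_rfl, hs.1.trans hs.2⟩ hs hs.1
  simpa [h.g_zero] using this

/-- An explicit integrable majorant for profiles. -/
lemma le_majorant (h : ProfileOn a B c S g p) (ha : 0 < a) (hB : 0 < B) (hc : 0 < c) :
    ∀ s ∈ Set.Icc 0 S, g s ≤ c * exp (3 * a * c) * (1 + a * s ^ 2 / 2) ^ (-(3 * B) / 2) := by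
  intro s hs
  have hg := h.pos s hs
  have hpos : 0 < 1 + a * s ^ 2 / 2 := by positivity
  have h1 := h.log_le ha hB s hs
  have h2 : 0 ≤ a * g s := by positivity
  rw [rpow_def_of_pos hpos]
  calc g s = exp (log (g s)) := (exp_log hg).symm
    _ ≤ exp (log c + 3 * a * c + log (1 + a * s ^ 2 / 2) * (-(3 * B) / 2)) := by
        rw [exp_le_exp]
        linarith
    _ = _ := by rw [exp_add, exp_add, exp_log hc]

lemma p_le_const (h : ProfileOn a B c S g p) (ha : 0 < a) (hB : 0 < B) :
    ∀ s ∈ Set.Icc 0 S, p s ≤ B * (1 + 1 / a) := by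
  intro s hs
  refine image_le_of_deriv_right_lt_deriv_boundary (a := 0) (b := S)
      (fun s hs => (h.hasDerivAt_p s hs).continuousAt.continuousWithinAt)
      (fun s hs => (h.hasDerivAt_p s (Set.Ico_subset_Icc_self hs)).hasDerivWithinAt)
      (by rw [h.p_zero]; positivity) (fun x => hasDerivAt_const x _)
      (fun x hx he => ?_) hs
  have hx' := Set.Ico_subset_Icc_self hx
  have hg := h.pos x hx'
  have h1 := (h.bounds_p ha hB x hx').2
  rw [he] at h1 ⊢
  have h2 : 1 + 1 / a ≤ x := le_of_mul_le_mul_left h1 hB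
  have h3 : 0 < 1 + 1 / a := by positivity
  have h4 : 0 < x * (B * (1 + 1 / a)) * (1 / (3 * g x)) := by
    have := h3.trans_le h2
    positivity
  have h5 : (1 + 1 / a) * (B * (1 + 1 / a)) * a ≤ x * (B * (1 + 1 / a)) * a := by gcongr
  have h6 : (1 + 1 / a) * (B * (1 + 1 / a)) * a = B * (a + 2 + 1 / a) := by
    field_simp
    ring
  have h7 : 0 < B * (a + 1 + 1 / a) := by positivity
  nlinarith

end ProfileOn

/-- Profiles on the whole line, in both directions from the origin. -/
def IsProfile (a B c : ℝ) (g p : ℝ → ℝ) : Prop :=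
  ∀ S, ProfileOn a B c S g p ∧ ProfileOn a B c S (fun s => g (-s)) (fun s => -p (-s))

lemma exists_isProfile {a B c : ℝ} (ha : 0 < a) (hB : 0 < B) (hc : 0 < c) :
    ∃ g p : ℝ → ℝ, IsProfile a B c g p := by
  choose G P h h' using fun n : ℕ => exists_profileOn (T := n) ha hB hc n.cast_nonneg
  have hagree : ∀ m n : ℕ, ∀ s : ℝ, |s| ≤ m → |s| ≤ n → G m s = G n s ∧ P m s = P n s := by
    intro m n s hm hn
    rcases le_total 0 s with hs | hs
    · rw [abs_of_nonneg hs] at hm hn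
      exact ((h m).mono hm).eqOn ha hB hc ((h n).mono hn) s ⟨hs, le_rfl⟩
    · rw [abs_of_nonpos hs] at hm hn
      have := ((h' m).mono hm).eqOn ha hB hc ((h' n).mono hn) (-s) ⟨by linarith, le_rfl⟩
      simpa using this
  let N : ℝ → ℕ := fun s => ⌈|s|⌉₊
  have hN : ∀ s, |s| ≤ N s := fun s => Nat.le_ceil _
  let g : ℝ → ℝ := fun s => G (N s) s
  let p : ℝ → ℝ := fun s => P (N s) s
  have hg : ∀ n : ℕ, ∀ s : ℝ, |s| ≤ n → g s = G n s := fun n s hs => (hagree _ _ s (hN s) hs).1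
  have hp : ∀ n : ℕ, ∀ s : ℝ, |s| ≤ n → p s = P n s := fun n s hs => (hagree _ _ s (hN s) hs).2
  have hev : ∀ n : ℕ, ∀ s : ℝ, |s| < n → ∀ᶠ t : ℝ in nhds s, |t| ≤ n := fun n s hs =>
    ((continuous_abs.tendsto s).eventually (gt_mem_nhds hs)).mono fun t ht => ht.le
  have hlt : ∀ S : ℝ, ∀ s ∈ Set.Icc 0 S, |s| < ((⌈S⌉₊ + 1 : ℕ) : ℝ) := fun S s hs => by
    rw [abs_of_nonneg hs.1]
    push_cast
    linarith [hs.2, Nat.le_ceil S]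
  refine ⟨g, p, fun S => ⟨?_, ?_⟩⟩
  · have H := h (⌈S⌉₊ + 1)
    set n := ⌈S⌉₊ + 1
    have hmem : ∀ s ∈ Set.Icc 0 S, s ∈ Set.Icc 0 (n : ℝ) := fun s hs =>
      ⟨hs.1, (le_abs_self s).trans (hlt S s hs).le⟩
    refine ⟨?_, ?_, fun s hs => ?_, fun s hs => ?_, fun s hs => ?_⟩
    · rw [hg n 0 (by simp), H.g_zero]
    · rw [hp n 0 (by simp), H.p_zero]
    · rw [hp n s (hlt S s hs).le]
      exact (H.hasDerivAt_g s (hmem s hs)).congr_of_eventuallyEq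
        ((hev n s (hlt S s hs)).mono fun t ht => hg n t ht)
    · rw [hp n s (hlt S s hs).le, hg n s (hlt S s hs).le]
      exact (H.hasDerivAt_p s (hmem s hs)).congr_of_eventuallyEq
        ((hev n s (hlt S s hs)).mono fun t ht => hp n t ht)
    · rw [hg n s (hlt S s hs).le]
      exact H.pos s (hmem s hs)
  · have H := h' (⌈S⌉₊ + 1)
    set n := ⌈S⌉₊ + 1
    have hmem : ∀ s ∈ Set.Icc 0 S, s ∈ Set.Icc 0 (n : ℝ) := fun s hs =>
      ⟨hs.1, (le_abs_self s).trans (hlt S s hs).le⟩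
    have hgn : ∀ s : ℝ, |s| ≤ n → g (-s) = G n (-s) := fun s hs => hg n (-s) (by rwa [abs_neg])
    have hpn : ∀ s : ℝ, |s| ≤ n → p (-s) = P n (-s) := fun s hs => hp n (-s) (by rwa [abs_neg])
    refine ⟨?_, ?_, fun s hs => ?_, fun s hs => ?_, fun s hs => ?_⟩
    · rw [hgn 0 (by simp), H.g_zero]
    · rw [hpn 0 (by simp), H.p_zero]
    · rw [hpn s (hlt S s hs).le]
      exact (H.hasDerivAt_g s (hmem s hs)).congr_of_eventuallyEq
        ((hev n s (hlt S s hs)).mono fun t ht => hgn t ht)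
    · rw [hpn s (hlt S s hs).le, hgn s (hlt S s hs).le]
      refine (H.hasDerivAt_p s (hmem s hs)).congr_of_eventuallyEq
        ((hev n s (hlt S s hs)).mono fun t ht => ?_)
      simp only [hpn t ht]
    · rw [hgn s (hlt S s hs).le]
      exact H.pos s (hmem s hs)

namespace IsProfile

variable {a B c : ℝ} {g p : ℝ → ℝ}

lemma even (h : IsProfile a B c g p) (ha : 0 < a) (hB : 0 < B) (hc : 0 < c) (s : ℝ) :
    g (-s) = g s ∧ p (-s) = -p s := by
  rcases le_total 0 s with hs | hs
  · have := (h s).1.eqOn ha hB hc (h s).2 s ⟨hs, le_rfl⟩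
    exact ⟨this.1.symm, by linarith [this.2]⟩
  · have := (h (-s)).1.eqOn ha hB hc (h (-s)).2 (-s) ⟨by linarith, le_rfl⟩
    simpa using this

lemma g_abs (h : IsProfile a B c g p) (ha : 0 < a) (hB : 0 < B) (hc : 0 < c) (s : ℝ) :
    g |s| = g s := by
  rcases abs_choice s with e | e <;> rw [e]
  exact (h.even ha hB hc s).1

lemma pos (h : IsProfile a B c g p) (ha : 0 < a) (hB : 0 < B) (hc : 0 < c) (s : ℝ) : 0 < g s := by
  rw [← h.g_abs ha hB hc]
  exact (h |s|).1.pos _ ⟨abs_nonneg s, le_rfl⟩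

lemma le_init (h : IsProfile a B c g p) (ha : 0 < a) (hB : 0 < B) (hc : 0 < c) (s : ℝ) :
    g s ≤ c := by
  rw [← h.g_abs ha hB hc]
  exact (h |s|).1.le_init ha hB _ ⟨abs_nonneg s, le_rfl⟩

lemma le_majorant (h : IsProfile a B c g p) (ha : 0 < a) (hB : 0 < B) (hc : 0 < c) (s : ℝ) :
    g s ≤ c * exp (3 * a * c) * (1 + a * s ^ 2 / 2) ^ (-(3 * B) / 2) := by
  rw [← h.g_abs ha hB hc, ← sq_abs]
  exact (h |s|).1.le_majorant ha hB hc _ ⟨abs_nonneg s, le_rfl⟩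

lemma abs_p_le (h : IsProfile a B c g p) (ha : 0 < a) (hB : 0 < B) (hc : 0 < c) (s : ℝ) :
    |p s| ≤ B * (1 + 1 / a) := by
  have key : ∀ s, 0 ≤ s → |p s| ≤ B * (1 + 1 / a) := fun s hs => by
    rw [abs_of_nonneg ((h s).1.bounds_p ha hB s ⟨hs, le_rfl⟩).1]
    exact (h s).1.p_le_const ha hB s ⟨hs, le_rfl⟩
  rcases le_total 0 s with hs | hs
  · exact key s hs
  · have := key (-s) (by linarith)
    rwa [(h.even ha hB hc s).2, abs_neg] at this

lemma hasDerivAt_g (h : IsProfile a B c g p) (s : ℝ) : HasDerivAt g (-p s) s := by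
  rcases le_total 0 s with hs | hs
  · exact (h s).1.hasDerivAt_g s ⟨hs, le_rfl⟩
  · have h1 := (h (-s)).2.hasDerivAt_g (-s) ⟨by linarith, le_rfl⟩
    have h2 := h1.scomp s (hasDerivAt_neg s)
    simpa [Function.comp_def] using h2

lemma hasDerivAt_p (h : IsProfile a B c g p) (s : ℝ) :
    HasDerivAt p (B - s * p s * (a + 1 / (3 * g s))) s := by
  rcases le_total 0 s with hs | hs
  · exact (h s).1.hasDerivAt_p s ⟨hs, le_rfl⟩
  · have h1 := (h (-s)).2.hasDerivAt_p (-s) ⟨by linarith, le_rfl⟩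
    have h2 := (h1.scomp s (hasDerivAt_neg s)).neg
    refine (h2.congr_of_eventuallyEq (Eventually.of_forall fun t => ?_)).congr_deriv ?_
    · simp
    · simp

lemma continuous_g (h : IsProfile a B c g p) : Continuous g :=
  continuous_iff_continuousAt.2 fun s => (h.hasDerivAt_g s).continuousAt

lemma continuous_p (h : IsProfile a B c g p) : Continuous p :=
  continuous_iff_continuousAt.2 fun s => (h.hasDerivAt_p s).continuousAt

end IsProfile

lemma integrable_majorant {a B : ℝ} (ha : 0 < a) (hB : 1 / 3 < B) :
    Integrable fun s : ℝ => (1 + a * s ^ 2 / 2) ^ (-(3 * B) / 2) := by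
  have h := integrable_rpow_neg_one_add_norm_sq (E := ℝ) (μ := volume) (r := 3 * B)
    (by simp; linarith)
  have h2 := h.comp_mul_left' (R := √(a / 2)) (by positivity)
  refine h2.congr (Eventually.of_forall fun s => ?_)
  simp only [norm_mul, mul_pow, Real.norm_eq_abs, sq_abs]
  rw [Real.sq_sqrt (by positivity)]
  congr 2
  ring

lemma tendsto_mul_majorant {a B : ℝ} (ha : 0 < a) (hB : 1 / 3 < B) :
    Tendsto (fun s : ℝ => s * (1 + a * s ^ 2 / 2) ^ (-(3 * B) / 2)) atTop (nhds 0) := by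
  have h1 : Tendsto (fun s : ℝ => 1 + a * s ^ 2 / 2) atTop atTop := by
    refine tendsto_atTop_add_const_left _ _ ?_
    exact (Tendsto.const_mul_atTop ha (tendsto_pow_atTop two_ne_zero)).atTop_div_const two_pos
  have h2 := (tendsto_rpow_neg_atTop (y := (3 * B - 1) / 2) (by linarith)).comp h1
  have h3 := h2.const_mul (√(2 / a))
  rw [mul_zero] at h3
  refine squeeze_zero' ((eventually_ge_atTop 0).mono fun s hs => by positivity)
    ((eventually_ge_atTop 0).mono fun s hs => ?_) h3
  have hpos : 0 < 1 + a * s ^ 2 / 2 := by positivity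
  have e : (1 + a * s ^ 2 / 2) ^ (-(3 * B) / 2)
      = (1 + a * s ^ 2 / 2) ^ (-((3 * B - 1) / 2)) / √(1 + a * s ^ 2 / 2) := by
    rw [Real.sqrt_eq_rpow, ← rpow_sub hpos]
    congr 1
    ring
  have h4 : s ≤ √(2 / a) * √(1 + a * s ^ 2 / 2) := by
    rw [← Real.sqrt_mul (by positivity)]
    refine Real.le_sqrt_of_sq_le ?_
    have : 2 / a * (1 + a * s ^ 2 / 2) = 2 / a + s ^ 2 := by
      field_simp
    have h5 : 0 < 2 / a := by positivity
    linarith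
  simp only [Function.comp]
  rw [e, mul_div_assoc', div_le_iff₀ (by positivity)]
  have h6 : 0 ≤ (1 + a * s ^ 2 / 2) ^ (-((3 * B - 1) / 2)) := by positivity
  nlinarith

namespace IsProfile

variable {a B c : ℝ} {g p : ℝ → ℝ}

lemma integrable_g (h : IsProfile a B c g p) (ha : 0 < a) (hB : 1 / 3 < B) (hc : 0 < c) :
    Integrable g := by
  have hB0 : 0 < B := by linarith
  refine ((integrable_majorant ha hB).const_mul (c * exp (3 * a * c))).mono'
    h.continuous_g.aestronglyMeasurable (Eventually.of_forall fun s => ?_)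
  rw [Real.norm_of_nonneg (h.pos ha hB0 hc s).le]
  exact h.le_majorant ha hB0 hc s

lemma integrable_g_sq (h : IsProfile a B c g p) (ha : 0 < a) (hB : 1 / 3 < B) (hc : 0 < c) :
    Integrable fun s => g s ^ 2 := by
  have hB0 : 0 < B := by linarith
  refine ((h.integrable_g ha hB hc).const_mul c).mono'
    (h.continuous_g.pow 2).aestronglyMeasurable (Eventually.of_forall fun s => ?_)
  rw [Real.norm_of_nonneg (by positivity), sq]
  exact mul_le_mul_of_nonneg_right (h.le_init ha hB0 hc s) (h.pos ha hB0 hc s).le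

lemma tendsto_mul_g (h : IsProfile a B c g p) (ha : 0 < a) (hB : 1 / 3 < B) (hc : 0 < c) :
    Tendsto (fun s => s * g s) atTop (nhds 0) := by
  have hB0 : 0 < B := by linarith
  have h1 := (tendsto_mul_majorant ha hB).const_mul (c * exp (3 * a * c))
  rw [mul_zero] at h1
  refine squeeze_zero' ((eventually_ge_atTop 0).mono fun s hs => ?_)
    ((eventually_ge_atTop 0).mono fun s hs => ?_) h1
  · exact mul_nonneg hs (h.pos ha hB0 hc s).le
  · have := mul_le_mul_of_nonneg_left (h.le_majorant ha hB0 hc s) hs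
    linarith

lemma tendsto_g (h : IsProfile a B c g p) (ha : 0 < a) (hB : 1 / 3 < B) (hc : 0 < c) :
    Tendsto g atTop (nhds 0) := by
  have hB0 : 0 < B := by linarith
  refine squeeze_zero' (Eventually.of_forall fun s => (h.pos ha hB0 hc s).le)
    ((eventually_ge_atTop 1).mono fun s hs => ?_) (h.tendsto_mul_g ha hB hc)
  nlinarith [h.pos ha hB0 hc s]

lemma integrable_p_sq (h : IsProfile a B c g p) (ha : 0 < a) (hB : 1 / 3 < B) (hc : 0 < c) :
    Integrable fun s => p s ^ 2 := by
  have hB0 : 0 < B := by linarith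
  have hp0 : ∀ s, 0 ≤ s → 0 ≤ p s := fun s hs => ((h s).1.bounds_p ha hB0 s ⟨hs, le_rfl⟩).1
  have h1 : IntegrableOn p (Set.Ioi 0) := by
    have := integrableOn_Ioi_deriv_of_nonpos' (a := 0) (fun x _ => h.hasDerivAt_g x)
      (fun x hx => by linarith [hp0 x (le_of_lt hx)]) (h.tendsto_g ha hB hc)
    simpa using this.neg
  have h2 : IntegrableOn (fun s => p s ^ 2) (Set.Ioi 0) := by
    refine (h1.const_mul (B * (1 + 1 / a))).mono' (h.continuous_p.pow 2).aestronglyMeasurable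
      ((ae_restrict_mem measurableSet_Ioi).mono fun s hs => ?_)
    have hp := hp0 s (le_of_lt hs)
    have := (le_abs_self _).trans (h.abs_p_le ha hB0 hc s)
    rw [Real.norm_of_nonneg (by positivity), sq]
    gcongr
  have h3 : IntegrableOn (fun s => p s ^ 2) (Set.Iio 0) := by
    have := IntegrableOn.comp_neg_Iio (c := (0 : ℝ)) (f := fun s => p s ^ 2) (by rwa [neg_zero])
    simpa [(h.even ha hB0 hc _).2] using this
  rw [← integrableOn_univ, ← Set.Iic_union_Ioi (a := 0)]
  exact (integrableOn_Iic_iff_integrableOn_Iio (by simp) |>.2 h3).union h2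

/-- The conservation identity obtained by integrating the profile equation. -/
lemma integral_identity {β : ℝ} (h : IsProfile a (β + 1 / 3) c g p) (ha : 0 < a) (hβ : 0 < β)
    (hc : 0 < c) :
    (∫ s, p s ^ 2) + a / 2 * (∫ s, g s ^ 2) = β * ∫ s, g s := by
  have hB : 1 / 3 < β + 1 / 3 := by linarith
  have hB0 : 0 < β + 1 / 3 := by linarith
  set Q : ℝ → ℝ := fun s => -(p s * g s) + a / 2 * ((s * g s) * g s) + s * g s / 3 with hQ
  have hd : ∀ s, HasDerivAt Q (p s ^ 2 + a / 2 * g s ^ 2 - β * g s) s := fun s => by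
    have hg := h.hasDerivAt_g s
    have hp := h.hasDerivAt_p s
    have hsg := (hasDerivAt_id s).mul hg
    have h1 := (((hp.mul hg).neg.add ((hsg.mul hg).const_mul (a / 2))).add (hsg.div_const 3))
    refine h1.congr_deriv ?_
    have := (h.pos ha hB0 hc s).ne'
    simp only [id, Pi.mul_apply]
    field_simp
    ring
  have i1 := h.integrable_p_sq ha hB hc
  have i2 := (h.integrable_g_sq ha hB hc).const_mul (a / 2)
  have i3 := (h.integrable_g ha hB hc).const_mul β
  have htop : Tendsto Q atTop (nhds 0) := by
    have t1 := h.tendsto_g ha hB hc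
    have t2 := h.tendsto_mul_g ha hB hc
    have t3 : Tendsto (fun s => p s * g s) atTop (nhds 0) := by
      have t4 := t1.const_mul ((β + 1 / 3) * (1 + 1 / a))
      rw [mul_zero] at t4
      refine squeeze_zero_norm (fun s => ?_) t4
      have := (h.pos ha hB0 hc s).le
      rw [norm_mul, Real.norm_eq_abs, Real.norm_of_nonneg this]
      exact mul_le_mul_of_nonneg_right (h.abs_p_le ha hB0 hc s) this
    simpa using (t3.neg.add ((t2.mul t1).const_mul (a / 2))).add (t2.div_const 3)
  have hbot : Tendsto Q atBot (nhds 0) := by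
    have h1 := (htop.comp tendsto_neg_atBot_atTop).neg
    rw [neg_zero] at h1
    refine h1.congr fun s => ?_
    simp only [hQ, Function.comp, (h.even ha hB0 hc s).1, (h.even ha hB0 hc s).2]
    ring
  have := integral_of_hasDerivAt_of_tendsto hd ((i1.add i2).sub i3) hbot htop
  rw [integral_sub (by exact i1.add i2) i3, integral_add i1 i2, integral_const_mul,
    integral_const_mul] at this
  linarith

end IsProfile

/-- Some profile has unit mass. -/
lemma exists_isProfile_integral_eq_one {a B : ℝ} (ha : 0 < a) (hB : 1 / 3 < B) :
    ∃ c g p, 0 < c ∧ IsProfile a B c g p ∧ ∫ s, g s = 1 := by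
  have hB0 : 0 < B := by linarith
  have hex : ∀ c : ℝ, ∃ g p : ℝ → ℝ, 0 < c → IsProfile a B c g p := fun c => by
    by_cases hc : 0 < c
    · obtain ⟨g, p, h⟩ := exists_isProfile ha hB0 hc
      exact ⟨g, p, fun _ => h⟩
    · exact ⟨0, 0, fun h => absurd h hc⟩
  choose G P H using hex
  have hJ := integrable_majorant ha hB
  set J := ∫ s : ℝ, (1 + a * s ^ 2 / 2) ^ (-(3 * B) / 2) with hJd
  have hJ0 : 0 ≤ J := integral_nonneg fun s => by positivity
  set c₁ := min 1 (1 / (exp (3 * a) * (J + 1))) with hc₁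
  have hc₁0 : 0 < c₁ := by positivity
  have hc₁1 : c₁ ≤ 1 := min_le_left _ _
  have hle : c₁ ≤ 1 + B := by linarith
  have hcont : ContinuousOn (fun c => ∫ s, G c s) (Set.Icc c₁ (1 + B)) := by
    refine continuousOn_of_dominated
      (bound := fun s => (1 + B) * exp (3 * a * (1 + B)) * (1 + a * s ^ 2 / 2) ^ (-(3 * B) / 2))
      (fun c hc => ((H c (hc₁0.trans_le hc.1)).continuous_g).aestronglyMeasurable)
      (fun c hc => Eventually.of_forall fun s => ?_) (hJ.const_mul _)
      (Eventually.of_forall fun s => ?_)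
    · have hc0 := hc₁0.trans_le hc.1
      rw [Real.norm_of_nonneg ((H c hc0).pos ha hB0 hc0 s).le]
      refine ((H c hc0).le_majorant ha hB0 hc0 s).trans ?_
      have := hc.2
      gcongr
    · intro c hc
      obtain ⟨M, hM⟩ := exists_abs_sub_le ha hB0 hc₁0 (abs_nonneg s)
      have hb : ∀ x ∈ Set.Icc c₁ (1 + B), |G x s - G c s| ≤ |x - c| * M := fun x hx => by
        have hx0 := hc₁0.trans_le hx.1
        have hc0 := hc₁0.trans_le hc.1
        rw [← (H x hx0).g_abs ha hB0 hx0 s, ← (H c hc0).g_abs ha hB0 hc0 s]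
        exact (hM x c _ _ _ _ hx.1 hc.1 (H x hx0 |s|).1 (H c hc0 |s|).1 |s|
          ⟨abs_nonneg s, le_rfl⟩).1
      have ht : Tendsto (fun x => |x - c| * M) (nhdsWithin c (Set.Icc c₁ (1 + B))) (nhds 0) := by
        have : Continuous fun x => |x - c| * M := by fun_prop
        simpa using (this.tendsto c).mono_left nhdsWithin_le_nhds
      rw [ContinuousWithinAt, tendsto_iff_dist_tendsto_zero]
      exact squeeze_zero' (Eventually.of_forall fun _ => dist_nonneg)
        (eventually_mem_nhdsWithin.mono fun x hx => by rw [Real.dist_eq]; exact hb x hx) ht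
  have hlow : ∫ s, G c₁ s ≤ 1 := by
    have h1 : ∫ s, G c₁ s ≤ c₁ * exp (3 * a * c₁) * J := by
      rw [hJd, ← integral_const_mul]
      exact integral_mono ((H c₁ hc₁0).integrable_g ha hB hc₁0) (hJ.const_mul _)
        fun s => (H c₁ hc₁0).le_majorant ha hB0 hc₁0 s
    have h2 : exp (3 * a * c₁) ≤ exp (3 * a) := exp_le_exp.2 (by nlinarith)
    have h3 : c₁ * (exp (3 * a) * (J + 1)) ≤ 1 :=
      (le_div_iff₀ (by positivity)).1 (min_le_right _ _)
    have h4 : c₁ * exp (3 * a * c₁) * J ≤ c₁ * exp (3 * a) * (J + 1) := by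
      gcongr
      linarith
    linarith
  have hhigh : 1 ≤ ∫ s, G (1 + B) s := by
    have hc0 : 0 < 1 + B := by linarith
    have h := H (1 + B) hc0
    have h1 : ∫ s in (0 : ℝ)..1, (1 : ℝ) ≤ ∫ s in (0 : ℝ)..1, G (1 + B) s := by
      refine intervalIntegral.integral_mono_on zero_le_one (by simp)
        (h.continuous_g.intervalIntegrable _ _) fun s hs => ?_
      have := (h 1).1.quadratic_le ha hB0 s hs
      have : B * s ^ 2 ≤ B * 1 := by
        gcongr
        exact pow_le_one₀ hs.1 hs.2
      linarith
    rw [intervalIntegral.integral_of_le (f := G (1 + B)) zero_le_one] at h1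
    have h2 := setIntegral_le_integral (s := Set.Ioc 0 1) (h.integrable_g ha hB hc0)
      (Eventually.of_forall fun s => (h.pos ha hB0 hc0 s).le)
    simp at h1
    linarith
  obtain ⟨c, hc, he⟩ := intermediate_value_Icc hle hcont ⟨hlow, hhigh⟩
  have hc0 := hc₁0.trans_le hc.1
  exact ⟨c, G c, P c, hc0, H c hc0, he⟩

theorem stmt_19 (a : ℝ) (ha : 0 < a) :
    ∀ β : ℝ, 0 < β →
      ∃ g : ℝ → ℝ, ContDiff ℝ 2 g ∧
        (∀ s : ℝ, 0 < g s) ∧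
        Integrable g ∧
        Integrable (fun s : ℝ => g s ^ 2) ∧
        Integrable (fun s : ℝ => deriv g s ^ 2) ∧
        (∫ s : ℝ, g s) = 1 ∧
        (∀ s : ℝ, deriv (deriv g) s * g s + a * s * deriv g s * g s
          + (∫ t : ℝ, deriv g t ^ 2) * g s
          + (a / 2) * (∫ t : ℝ, g t ^ 2) * g s
          + (1 / 3) * g s + (1 / 3) * s * deriv g s = 0) ∧
        (∫ t : ℝ, deriv g t ^ 2) + (a / 2) * (∫ t : ℝ, g t ^ 2) = β := by
  intro β hβ
  have hB : 1 / 3 < β + 1 / 3 := by linarith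
  have hB0 : 0 < β + 1 / 3 := by linarith
  obtain ⟨c, g, p, hc, h, hmass⟩ := exists_isProfile_integral_eq_one ha hB
  have hpos := h.pos ha hB0 hc
  have hdg : deriv g = fun s => -p s := funext fun s => (h.hasDerivAt_g s).deriv
  have hddg : deriv (fun s => -p s) =
      fun s => -(β + 1 / 3 - s * p s * (a + 1 / (3 * g s))) :=
    funext fun s => (h.hasDerivAt_p s).neg.deriv
  have hid : (∫ t : ℝ, p t ^ 2) + (a / 2) * (∫ t : ℝ, g t ^ 2) = β := by
    rw [h.integral_identity ha hβ hc, hmass, mul_one]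
  have hsmooth : ContDiff ℝ 2 g := by
    rw [show (2 : WithTop ℕ∞) = 1 + 1 from rfl, contDiff_succ_iff_deriv]
    refine ⟨fun s => (h.hasDerivAt_g s).differentiableAt, by simp, ?_⟩
    rw [hdg, contDiff_one_iff_deriv, hddg]
    refine ⟨fun s => (h.hasDerivAt_p s).neg.differentiableAt, ?_⟩
    have h1 := h.continuous_g
    have h2 := h.continuous_p
    have h3 : ∀ s, 3 * g s ≠ 0 := fun s => by
      have := hpos s
      positivity
    fun_prop (disch := exact h3 _)
  refine ⟨g, hsmooth, hpos, h.integrable_g ha hB hc, h.integrable_g_sq ha hB hc, ?_, hmass, ?_, ?_⟩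
  · simpa [hdg] using h.integrable_p_sq ha hB hc
  · intro s
    rw [hdg, hddg]
    simp only [neg_sq]
    have hg := (hpos s).ne'
    have e : -(β + 1 / 3 - s * p s * (a + 1 / (3 * g s))) * g s + a * s * -p s * g s
        + β * g s + 1 / 3 * g s + 1 / 3 * s * -p s = 0 := by
      field_simp
      ring
    have e' : (∫ t : ℝ, p t ^ 2) * g s + (a / 2) * (∫ t : ℝ, g t ^ 2) * g s = β * g s := by
      rw [← add_mul, hid]
    linarith
  · simpa [hdg] using hid
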